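/- arXiv:1902.00931 — 4 statements merged into one kernel-verified Lean document; each statement's English description precedes it below -/
import Mathlib

section
/- Let M be a symmetric positive definite n × n real matrix and c > 0. Then the maximum of ‖x − y‖₂² over pairs x, y ∈ ℝ^n with xᵀ M x ≤ c and yᵀ M y ≤ c is attained and equals 4c · λ_max(M⁻¹) = 4c / λ_min(M), where λ_max(M⁻¹) is the largest eigenvalue of M⁻¹ and λ_min(M) the smallest eigenvalue of M. Hence minimizing the maximal squared Euclidean distance between two points of the ellipsoid (the exact E-criterion applied to an ellipsoidal confidence region) is equivalent to minimizing the largest eigenvalue of M⁻¹ (the classical E-criterion). -/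
open Matrix Finset

theorem Matrix.IsHermitian.iInf_eigenvalues_mul_dotProduct_le {n : ℕ}
    {M : Matrix (Fin n) (Fin n) ℝ} (hM : M.IsHermitian) (x : Fin n → ℝ) :
    (⨅ i, hM.eigenvalues i) * (x ⬝ᵥ x) ≤ x ⬝ᵥ M.mulVec x := by
  have h : (M - algebraMap ℝ _ (⨅ i, hM.eigenvalues i)).PosSemidef := by
    rw [posSemidef_iff_isHermitian_and_spectrum_nonneg]
    refine ⟨hM.sub ?_, ?_⟩
    · rw [algebraMap_eq_diagonal]
      exact isHermitian_diagonal _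
    · rw [← spectrum.sub_singleton_eq, hM.spectrum_real_eq_range_eigenvalues]
      rintro _ ⟨_, ⟨i, rfl⟩, _, rfl, rfl⟩
      exact sub_nonneg.2 (ciInf_le (Set.finite_range hM.eigenvalues).bddBelow i)
  have := h.dotProduct_mulVec_nonneg x
  simp only [star_trivial, sub_mulVec, dotProduct_sub, Algebra.algebraMap_eq_smul_one, smul_mulVec,
    one_mulVec, dotProduct_smul, smul_eq_mul] at this
  linarith

theorem Matrix.PosDef.iSup_eigenvalues_inv {n : ℕ} {M : Matrix (Fin n) (Fin n) ℝ}
    (hM : M.PosDef) : (⨆ i, hM.inv.1.eigenvalues i) = (⨅ i, hM.1.eigenvalues i)⁻¹ := by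
  rcases isEmpty_or_nonempty (Fin n) with _ | _
  · simp
  have hr : Set.range hM.inv.1.eigenvalues = (Set.range hM.1.eigenvalues)⁻¹ := by
    rw [← hM.1.spectrum_real_eq_range_eigenvalues, ← hM.inv.1.spectrum_real_eq_range_eigenvalues]
    obtain ⟨u, rfl⟩ := hM.isUnit
    rw [← coe_units_inv, spectrum.map_inv]
  obtain ⟨i, hi⟩ := exists_eq_ciInf_of_finite (f := hM.1.eigenvalues)
  refine le_antisymm (ciSup_le fun j => ?_) ?_
  · obtain ⟨k, hk⟩ : (hM.inv.1.eigenvalues j)⁻¹ ∈ Set.range hM.1.eigenvalues :=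
      Set.mem_inv.1 (hr ▸ Set.mem_range_self j)
    rw [← inv_inv (hM.inv.1.eigenvalues j), ← hk]
    exact inv_anti₀ (hi ▸ hM.eigenvalues_pos i) (ciInf_le (Set.finite_range _).bddBelow k)
  · obtain ⟨j, hj⟩ : (hM.1.eigenvalues i)⁻¹ ∈ Set.range hM.inv.1.eigenvalues := by
      rw [hr, Set.inv_mem_inv]
      exact Set.mem_range_self i
    rw [← hi, ← hj]
    exact le_ciSup (Set.finite_range _).bddAbove j

/-- The maximal squared Euclidean distance between two points of the ellipsoid
`{x : xᵀMx ≤ c}` is attained and equals `4c·λ_max(M⁻¹) = 4c/λ_min(M)`. -/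
theorem stmt_8 {n : ℕ} (M : Matrix (Fin n) (Fin n) ℝ) (hM : M.PosDef)
    (c : ℝ) (hc : 0 < c) :
    IsGreatest
      {d : ℝ | ∃ x y : Fin n → ℝ, x ⬝ᵥ M.mulVec x ≤ c ∧ y ⬝ᵥ M.mulVec y ≤ c ∧
        d = ∑ i, (x i - y i) ^ 2}
      (4 * c * ⨆ i, hM.inv.1.eigenvalues i) ∧
    4 * c * (⨆ i, hM.inv.1.eigenvalues i) = 4 * c / ⨅ i, hM.1.eigenvalues i := by
  rw [hM.iSup_eigenvalues_inv, ← div_eq_mul_inv]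
  refine ⟨?_, rfl⟩
  rcases isEmpty_or_nonempty (Fin n) with _ | _
  · simp [IsGreatest, upperBounds, dotProduct, hc.le]
  obtain ⟨i, hi⟩ := exists_eq_ciInf_of_finite (f := hM.1.eigenvalues)
  have hm := hM.eigenvalues_pos i
  have hle := hM.1.iInf_eigenvalues_mul_dotProduct_le
  rw [← hi] at hle ⊢
  set m := hM.1.eigenvalues i
  constructor
  · set v : Fin n → ℝ := ⇑(hM.1.eigenvectorBasis i)
    have hMv : M.mulVec v = m • v := hM.1.mulVec_eigenvectorBasis i
    have hvv : v ⬝ᵥ v = 1 := by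
      have h := (EuclideanSpace.real_norm_sq_eq (hM.1.eigenvectorBasis i)).symm
      rw [hM.1.eigenvectorBasis.norm_eq_one] at h
      simpa [dotProduct, ← sq] using h
    have hs : √(c / m) ^ 2 = c / m := Real.sq_sqrt (by positivity)
    have hq : √(c / m) * (m * √(c / m)) = c := by
      rw [mul_left_comm, ← sq, hs, mul_div_cancel₀ _ hm.ne']
    refine ⟨√(c / m) • v, -(√(c / m) • v), ?_, ?_, ?_⟩
    · simp [mulVec_smul, hMv, hvv, hq]
    · simp [mulVec_neg, mulVec_smul, hMv, hvv, hq]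
    · calc 4 * c / m = 4 * √(c / m) ^ 2 * (v ⬝ᵥ v) := by rw [hs, hvv]; ring
        _ = _ := by
          rw [dotProduct, Finset.mul_sum]
          refine Finset.sum_congr rfl fun j _ => ?_
          simp only [Pi.smul_apply, Pi.neg_apply, smul_eq_mul]
          ring
  · rintro _ ⟨x, y, hx, hy, rfl⟩
    have hsub : (x - y) ⬝ᵥ M.mulVec (x - y) = x ⬝ᵥ M.mulVec x - y ⬝ᵥ M.mulVec x -
        (x ⬝ᵥ M.mulVec y - y ⬝ᵥ M.mulVec y) := by
      simp only [mulVec_sub, dotProduct_sub, sub_dotProduct]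
    have hadd := hM.posSemidef.dotProduct_mulVec_nonneg (x + y)
    have hsum : ∑ j, (x j - y j) ^ 2 = (x - y) ⬝ᵥ (x - y) := by
      simp [dotProduct, sq]
    rw [hsum, le_div_iff₀ hm]
    simp only [star_trivial, mulVec_add, dotProduct_add, add_dotProduct] at hadd
    linarith [hle (x - y)]
end

section
/- For the linear model with positive definite Fisher information matrix FIM and minimizer p̂ of the weighted least-squares objective J_w, the exact A-criterion of the exact confidence region P_w = {p : J_w(p) − J_w(p̂) ≤ χ²_{α,n_p}} — namely the sum over coordinates j of the width of P_w along the j-th axis — equals 2 √(χ²_{α,n_p}) · Σ_{j=1}^{n_p} √((FIM⁻¹)_{jj}). -/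
open Matrix Finset

/-- A quadratic polynomial without constant term that is nonnegative has no linear term. -/
lemma eq_zero_of_forall_quadratic_nonneg {a b : ℝ} (h : ∀ t : ℝ, 0 ≤ a * (t * t) + b * t) :
    b = 0 := by
  have := discrim_le_zero (a := a) (b := b) (c := 0) fun t => by simpa using h t
  simp only [discrim, mul_zero, sub_zero] at this
  exact pow_eq_zero_iff two_ne_zero |>.1 (le_antisymm this (sq_nonneg b))

namespace Matrix

variable {n : Type*} [Fintype n] [DecidableEq n]

lemma PosDef.mulVec_inv_mulVec {A : Matrix n n ℝ} (hA : A.PosDef) (v : n → ℝ) :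
    A *ᵥ (A⁻¹ *ᵥ v) = v := by
  rw [mulVec_mulVec, mul_nonsing_inv _ ((isUnit_iff_isUnit_det A).1 hA.isUnit), one_mulVec]

/-- The Cauchy-Schwarz inequality between a vector and a coordinate functional. -/
lemma PosDef.sq_apply_le {A : Matrix n n ℝ} (hA : A.PosDef) (j : n) (d : n → ℝ) :
    d j ^ 2 ≤ A⁻¹ j j * (d ⬝ᵥ A *ᵥ d) := by
  set e : n → ℝ := A⁻¹ *ᵥ Pi.single j 1 with he
  have hAe : A *ᵥ e = Pi.single j 1 := hA.mulVec_inv_mulVec _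
  have hej : e j = A⁻¹ j j := by simp [he]
  have hed : e ⬝ᵥ A *ᵥ d = d j := by
    have hT : Aᵀ = A := by simpa using hA.isHermitian.eq
    rw [dotProduct_mulVec, ← mulVec_transpose, hT, hAe, single_one_dotProduct]
  have key : ∀ s : ℝ, 0 ≤ A⁻¹ j j * (s * s) + (-2 * d j) * s + d ⬝ᵥ A *ᵥ d := fun s => by
    have h : 0 ≤ (d - s • e) ⬝ᵥ A *ᵥ (d - s • e) := by
      simpa using hA.posSemidef.dotProduct_mulVec_nonneg (d - s • e)
    simp only [mulVec_sub, mulVec_smul, hAe, sub_dotProduct, dotProduct_sub, smul_dotProduct,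
      dotProduct_smul, hed, dotProduct_single_one, Pi.sub_apply, Pi.smul_apply, hej,
      smul_eq_mul] at h
    linarith
  have := discrim_le_zero key
  simp only [discrim] at this
  linarith

/-- The coordinate projection of an ellipsoid attains its maximum
`x j + √c * √((A⁻¹) j j)` and its minimum `x j - √c * √((A⁻¹) j j)`. -/
lemma PosDef.isGreatest_isLeast_image_ellipsoid {A : Matrix n n ℝ} (hA : A.PosDef) (x : n → ℝ)
    {c : ℝ} (hc : 0 ≤ c) (j : n) :
    IsGreatest ((fun p => p j) '' {p : n → ℝ | (p - x) ⬝ᵥ A *ᵥ (p - x) ≤ c})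
        (x j + √c * √(A⁻¹ j j)) ∧
      IsLeast ((fun p => p j) '' {p : n → ℝ | (p - x) ⬝ᵥ A *ᵥ (p - x) ≤ c})
        (x j - √c * √(A⁻¹ j j)) := by
  have hpos : 0 < A⁻¹ j j := hA.inv.diag_pos
  have bound : ∀ p : n → ℝ, (p - x) ⬝ᵥ A *ᵥ (p - x) ≤ c →
      |p j - x j| ≤ √c * √(A⁻¹ j j) := fun p hp => by
    rw [← Real.sqrt_mul hc]
    refine Real.abs_le_sqrt ((hA.sq_apply_le j (p - x)).trans ?_)
    rw [mul_comm]
    gcongr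
  have attained : ∀ s : ℝ, s ^ 2 * A⁻¹ j j = c →
      x j + s * A⁻¹ j j ∈ (fun p => p j) '' {p : n → ℝ | (p - x) ⬝ᵥ A *ᵥ (p - x) ≤ c} :=
    fun s hs => by
      refine ⟨x + s • (A⁻¹ *ᵥ Pi.single j 1), ?_, by simp⟩
      simp only [Set.mem_ofPred_eq, add_sub_cancel_left, mulVec_smul, hA.mulVec_inv_mulVec,
        dotProduct_smul, dotProduct_single_one, Pi.smul_apply, smul_eq_mul]
      simp only [mulVec_single_one, col_apply]
      linarith
  have hsq : √(A⁻¹ j j) ^ 2 = A⁻¹ j j := Real.sq_sqrt hpos.le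
  have hne : √(A⁻¹ j j) ≠ 0 := (Real.sqrt_pos.2 hpos).ne'
  have hmul : √c / √(A⁻¹ j j) * A⁻¹ j j = √c * √(A⁻¹ j j) := by
    nth_rewrite 2 [← hsq]
    field_simp
  have hs : (√c / √(A⁻¹ j j)) ^ 2 * A⁻¹ j j = c := by
    rw [div_pow, hsq, Real.sq_sqrt hc, div_mul_cancel₀ _ hpos.ne']
  refine ⟨⟨?_, ?_⟩, ⟨?_, ?_⟩⟩
  · simpa only [hmul] using attained _ hs
  · rintro _ ⟨p, hp, rfl⟩
    have := (abs_le.1 (bound p hp)).2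
    dsimp only
    linarith
  · simpa only [neg_mul, hmul, ← sub_eq_add_neg] using
      attained (-(√c / √(A⁻¹ j j))) (by rwa [neg_sq])
  · rintro _ ⟨p, hp, rfl⟩
    have := (abs_le.1 (bound p hp)).1
    dsimp only
    linarith

end Matrix

/-- The quadratic form of a sum of weighted Gram matrices is a weighted sum of squares. -/
lemma dotProduct_sum_gram_mulVec {ι m n : Type*} [Fintype ι] [Fintype m] [Fintype n]
    [DecidableEq m] (Q : ι → Matrix m n ℝ) (w : m → ℝ) (d : n → ℝ) :
    d ⬝ᵥ (∑ τ, (Q τ)ᵀ * Matrix.diagonal w * Q τ) *ᵥ d =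
      ∑ i, ∑ τ, w i * (Q τ *ᵥ d) i ^ 2 := by
  rw [Matrix.sum_mulVec, dotProduct_sum, Finset.sum_comm]
  refine Finset.sum_congr rfl fun τ _ => ?_
  rw [← mulVec_mulVec, ← mulVec_mulVec, dotProduct_mulVec, vecMul_transpose]
  simp only [dotProduct, mulVec_diagonal]
  exact Finset.sum_congr rfl fun i _ => by ring

/-- At a minimizer of a weighted least-squares objective the excess is its quadratic part. -/
lemma weightedLeastSquares_sub_min {ι m n : Type*} [Fintype ι] [Fintype m] [Fintype n]
    (Q : ι → Matrix m n ℝ) (y : ι → m → ℝ) (w : m → ℝ) (J : (n → ℝ) → ℝ)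
    (hJ : ∀ p, J p = ∑ i, ∑ τ, w i * (y τ i - (Q τ *ᵥ p) i) ^ 2)
    (x : n → ℝ) (hx : ∀ p, J x ≤ J p) (p : n → ℝ) :
    J p - J x = ∑ i, ∑ τ, w i * (Q τ *ᵥ (p - x)) i ^ 2 := by
  set d := p - x with hd
  set a := ∑ i, ∑ τ, w i * (Q τ *ᵥ d) i ^ 2 with ha
  set b := ∑ i, ∑ τ, -2 * (w i * (y τ i - (Q τ *ᵥ x) i) * (Q τ *ᵥ d) i) with hb
  have expand : ∀ t : ℝ, J (x + t • d) - J x = a * (t * t) + b * t := fun t => by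
    simp only [hJ, ha, hb, Finset.sum_mul, ← Finset.sum_sub_distrib, ← Finset.sum_add_distrib,
      mulVec_add, mulVec_smul, Pi.add_apply, Pi.smul_apply, smul_eq_mul]
    exact Finset.sum_congr rfl fun i _ => Finset.sum_congr rfl fun τ _ => by ring
  have hb0 : b = 0 := eq_zero_of_forall_quadratic_nonneg (a := a) fun t => by
    rw [← expand]
    exact sub_nonneg.2 (hx _)
  simpa [hb0, hd] using expand 1

/-- Exact A-criterion in the linear case: the sum of the coordinate widths of the exact
confidence region equals `2√(χ²) Σ_j √((FIM⁻¹)_{jj})`. -/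
theorem stmt_10 {np ny N : ℕ}
    (Q : Fin N → Matrix (Fin ny) (Fin np) ℝ)
    (ym : Fin N → Fin ny → ℝ)
    (σ : Fin ny → ℝ) (hσ : ∀ i, 0 < σ i)
    (Jw : (Fin np → ℝ) → ℝ)
    (hJw : ∀ p, Jw p = ∑ i, ∑ τ, (σ i ^ 2)⁻¹ * (ym τ i - (Q τ).mulVec p i) ^ 2)
    (FIM : Matrix (Fin np) (Fin np) ℝ)
    (hFIM : FIM = ∑ τ, (Q τ)ᵀ * Matrix.diagonal (fun i => (σ i ^ 2)⁻¹) * Q τ)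
    (hpd : FIM.PosDef)
    (phat : Fin np → ℝ) (hphat : ∀ p, Jw phat ≤ Jw p)
    (χ2 : ℝ) (hχ2 : 0 < χ2) :
    ∑ j : Fin np,
        (sSup ((fun p => p j) '' {p : Fin np → ℝ | Jw p - Jw phat ≤ χ2}) -
          sInf ((fun p => p j) '' {p : Fin np → ℝ | Jw p - Jw phat ≤ χ2})) =
      2 * Real.sqrt χ2 * ∑ j : Fin np, Real.sqrt (FIM⁻¹ j j) := by
  have hset : {p : Fin np → ℝ | Jw p - Jw phat ≤ χ2} =
      {p | (p - phat) ⬝ᵥ FIM *ᵥ (p - phat) ≤ χ2} := by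
    ext p
    rw [Set.mem_ofPred_eq, Set.mem_ofPred_eq, hFIM, dotProduct_sum_gram_mulVec,
      weightedLeastSquares_sub_min Q ym _ Jw hJw phat hphat]
  rw [hset, Finset.mul_sum]
  refine Finset.sum_congr rfl fun j _ => ?_
  obtain ⟨hmax, hmin⟩ := hpd.isGreatest_isLeast_image_ellipsoid phat hχ2.le j
  rw [hmax.csSup_eq, hmin.csInf_eq]
  ring
end

section
/- For the linear model with positive definite Fisher information matrix FIM and minimizer p̂ of the weighted least-squares objective J_w, the exact E-criterion of the exact confidence region P_w = {p : J_w(p) − J_w(p̂) ≤ χ²_{α,n_p}} — namely the maximum of ‖φ₁ − φ₂‖₂² over φ₁, φ₂ ∈ P_w — equals 4 χ²_{α,n_p} · λ_max(FIM⁻¹), where λ_max(FIM⁻¹) is the largest eigenvalue of FIM⁻¹. Hence in the linear case the exact E-optimal design coincides with the classical E-optimal design minimizing the largest eigenvalue of FIM⁻¹. -/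
open Matrix Finset

/-- A least-squares objective grows away from its minimizer by the quadratic form of its
information matrix. -/
theorem weighted_least_squares_sub_min {np ny N : ℕ}
    (Q : Fin N → Matrix (Fin ny) (Fin np) ℝ) (y : Fin N → Fin ny → ℝ) (w : Fin ny → ℝ)
    (J : (Fin np → ℝ) → ℝ)
    (hJ : ∀ p, J p = ∑ i, ∑ τ, w i * (y τ i - (Q τ *ᵥ p) i) ^ 2)
    (p₀ : Fin np → ℝ) (hp₀ : ∀ p, J p₀ ≤ J p) (v : Fin np → ℝ) :
    J (p₀ + v) - J p₀ = v ⬝ᵥ (∑ τ, (Q τ)ᵀ * diagonal w * Q τ) *ᵥ v := by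
  set B : ℝ := ∑ i, ∑ τ, w i * (y τ i - (Q τ *ᵥ p₀) i) * (Q τ *ᵥ v) i with hB
  set C : ℝ := ∑ i, ∑ τ, w i * (Q τ *ᵥ v) i ^ 2 with hC
  have expand (t : ℝ) : J (p₀ + t • v) - J p₀ = C * t ^ 2 - 2 * B * t := by
    rw [hJ, hJ, hB, hC]
    simp only [Finset.mul_sum, Finset.sum_mul, ← Finset.sum_sub_distrib, mulVec_add, mulVec_smul,
      Pi.add_apply, Pi.smul_apply, smul_eq_mul]
    refine Finset.sum_congr rfl fun i _ => Finset.sum_congr rfl fun τ _ => ?_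
    ring
  have B_zero : B = 0 := by
    have h (t : ℝ) : 0 ≤ C * (t * t) + (-2 * B) * t + 0 := by
      have := expand t
      have := hp₀ (p₀ + t • v)
      linarith
    have := discrim_le_zero h
    rw [discrim] at this
    nlinarith [sq_nonneg B]
  have hquad : v ⬝ᵥ (∑ τ, (Q τ)ᵀ * diagonal w * Q τ) *ᵥ v = C := by
    rw [sum_mulVec, dotProduct_sum, hC, Finset.sum_comm]
    refine Finset.sum_congr rfl fun τ _ => ?_
    rw [← mulVec_mulVec, ← mulVec_mulVec, dotProduct_mulVec, vecMul_transpose, dotProduct]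
    refine Finset.sum_congr rfl fun i _ => ?_
    rw [mulVec_diagonal]
    ring
  have := expand 1
  rw [one_smul] at this
  rw [this, hquad, B_zero]
  ring

theorem Matrix.PosDef.mulVec_eigenvectorBasis_inv {n : Type*} [Fintype n] [DecidableEq n]
    {M : Matrix n n ℝ} (hM : M.PosDef) (i : n) :
    M *ᵥ (hM.inv.1.eigenvectorBasis i).ofLp =
      (hM.inv.1.eigenvalues i)⁻¹ • (hM.inv.1.eigenvectorBasis i).ofLp := by
  have hunit : IsUnit M.det := hM.det_pos.ne'.isUnit
  have h := congrArg (M *ᵥ ·) (hM.inv.1.mulVec_eigenvectorBasis i)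
  simp only [mulVec_mulVec, mul_nonsing_inv _ hunit, one_mulVec, mulVec_smul] at h
  rw [eq_inv_smul_iff₀ (hM.inv.eigenvalues_pos i).ne']
  exact h.symm

theorem Matrix.PosDef.dotProduct_self_le_iSup_eigenvalues_inv {n : Type*} [Fintype n]
    [DecidableEq n] {M : Matrix n n ℝ} (hM : M.PosDef) (v : n → ℝ) :
    v ⬝ᵥ v ≤ (⨆ i, hM.inv.1.eigenvalues i) * (v ⬝ᵥ M *ᵥ v) := by
  set b := hM.inv.1.eigenvectorBasis
  have hsym (x y : n → ℝ) : x ⬝ᵥ M *ᵥ y = M *ᵥ x ⬝ᵥ y := by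
    rw [dotProduct_mulVec, ← mulVec_transpose, ← conjTranspose_eq_transpose_of_trivial, hM.1.eq]
  have parseval (x y : n → ℝ) :
      x ⬝ᵥ y = ∑ i, ((b i).ofLp ⬝ᵥ x) * ((b i).ofLp ⬝ᵥ y) := by
    have h := b.sum_inner_mul_inner (WithLp.toLp 2 x) (WithLp.toLp 2 y)
    simp only [EuclideanSpace.inner_eq_star_dotProduct, star_trivial] at h
    rw [dotProduct_comm, ← h]
    exact Finset.sum_congr rfl fun i _ => by rw [dotProduct_comm y]
  rw [parseval v v, parseval v (M *ᵥ v), Finset.mul_sum]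
  refine Finset.sum_le_sum fun i _ => ?_
  have hpos := hM.inv.eigenvalues_pos i
  have hle : hM.inv.1.eigenvalues i ≤ ⨆ j, hM.inv.1.eigenvalues j :=
    le_ciSup (Set.finite_range _).bddAbove i
  rw [hsym, hM.mulVec_eigenvectorBasis_inv, smul_dotProduct, smul_eq_mul]
  calc _ = hM.inv.1.eigenvalues i * (hM.inv.1.eigenvalues i)⁻¹ * ((b i).ofLp ⬝ᵥ v) ^ 2 := by
        rw [mul_inv_cancel₀ hpos.ne']; ring
    _ ≤ (⨆ j, hM.inv.1.eigenvalues j) * (hM.inv.1.eigenvalues i)⁻¹ * ((b i).ofLp ⬝ᵥ v) ^ 2 := by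
        gcongr
    _ = _ := by ring

/-- Some point of the ellipsoid `{v | vᵀ M v ≤ c}` lies at squared distance `c · λ_max(M⁻¹)` from
its centre. -/
theorem Matrix.PosDef.exists_dotProduct_mulVec_eq {n : Type*} [Fintype n] [DecidableEq n]
    {M : Matrix n n ℝ} (hM : M.PosDef) {c : ℝ} (hc : 0 ≤ c) :
    ∃ v : n → ℝ, v ⬝ᵥ M *ᵥ v ≤ c ∧ v ⬝ᵥ v = c * ⨆ i, hM.inv.1.eigenvalues i := by
  cases isEmpty_or_nonempty n
  · exact ⟨0, by simpa using hc, by simp⟩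
  obtain ⟨i, hi⟩ := exists_eq_ciSup_of_finite (f := hM.inv.1.eigenvalues)
  have hpos := hM.inv.eigenvalues_pos i
  have hnorm : (hM.inv.1.eigenvectorBasis i).ofLp ⬝ᵥ (hM.inv.1.eigenvectorBasis i).ofLp = 1 := by
    have h := hM.inv.1.eigenvectorBasis.inner_eq_one i
    rwa [EuclideanSpace.inner_eq_star_dotProduct, star_trivial] at h
  have hsq := Real.mul_self_sqrt (mul_nonneg hc hpos.le)
  refine ⟨√(c * hM.inv.1.eigenvalues i) • (hM.inv.1.eigenvectorBasis i).ofLp, ?_, ?_⟩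
  · rw [mulVec_smul, hM.mulVec_eigenvectorBasis_inv]
    simp only [smul_dotProduct, dotProduct_smul, smul_eq_mul, hnorm]
    rw [mul_one, mul_left_comm, hsq, mul_left_comm, inv_mul_cancel₀ hpos.ne', mul_one]
  · simp only [smul_dotProduct, dotProduct_smul, smul_eq_mul, hnorm]
    rw [mul_one, hsq, hi]

theorem Matrix.PosSemidef.dotProduct_mulVec_sub_le {n : Type*} [Fintype n]
    {M : Matrix n n ℝ} (hM : M.PosSemidef) (u v : n → ℝ) :
    (u - v) ⬝ᵥ M *ᵥ (u - v) ≤ 2 * (u ⬝ᵥ M *ᵥ u) + 2 * (v ⬝ᵥ M *ᵥ v) := by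
  have h := hM.dotProduct_mulVec_nonneg (u + v)
  simp only [star_trivial, mulVec_add, add_dotProduct, dotProduct_add] at h
  simp only [mulVec_sub, sub_dotProduct, dotProduct_sub]
  linarith

/-- Exact E-criterion in the linear case: the maximal squared Euclidean distance between
two points of the exact confidence region is attained and equals
`4χ²·λ_max(FIM⁻¹)`. -/
theorem stmt_11 {np ny N : ℕ}
    (Q : Fin N → Matrix (Fin ny) (Fin np) ℝ)
    (ym : Fin N → Fin ny → ℝ)
    (σ : Fin ny → ℝ) (hσ : ∀ i, 0 < σ i)
    (Jw : (Fin np → ℝ) → ℝ)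
    (hJw : ∀ p, Jw p = ∑ i, ∑ τ, (σ i ^ 2)⁻¹ * (ym τ i - (Q τ).mulVec p i) ^ 2)
    (FIM : Matrix (Fin np) (Fin np) ℝ)
    (hFIM : FIM = ∑ τ, (Q τ)ᵀ * Matrix.diagonal (fun i => (σ i ^ 2)⁻¹) * Q τ)
    (hpd : FIM.PosDef)
    (phat : Fin np → ℝ) (hphat : ∀ p, Jw phat ≤ Jw p)
    (χ2 : ℝ) (hχ2 : 0 < χ2) :
    IsGreatest
      {d : ℝ | ∃ φ₁ ∈ {p : Fin np → ℝ | Jw p - Jw phat ≤ χ2},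
        ∃ φ₂ ∈ {p : Fin np → ℝ | Jw p - Jw phat ≤ χ2},
          d = ∑ i, (φ₁ i - φ₂ i) ^ 2}
      (4 * χ2 * ⨆ i, hpd.inv.1.eigenvalues i) := by
  have hgrow (v : Fin np → ℝ) : Jw (phat + v) - Jw phat = v ⬝ᵥ FIM *ᵥ v :=
    hFIM ▸ weighted_least_squares_sub_min Q ym (fun i => (σ i ^ 2)⁻¹) Jw hJw phat hphat v
  have hdist (φ₁ φ₂ : Fin np → ℝ) : ∑ i, (φ₁ i - φ₂ i) ^ 2 = (φ₁ - φ₂) ⬝ᵥ (φ₁ - φ₂) := by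
    simp [dotProduct, sq]
  constructor
  · obtain ⟨v, hv, hvv⟩ := hpd.exists_dotProduct_mulVec_eq hχ2.le
    refine ⟨phat + v, ?_, phat + -v, ?_, ?_⟩
    · rwa [Set.mem_ofPred_eq, hgrow]
    · rw [Set.mem_ofPred_eq, hgrow]
      simpa [mulVec_neg] using hv
    · rw [hdist, mul_assoc, ← hvv]
      simp only [add_sub_add_left_eq_sub, sub_neg_eq_add, add_dotProduct, dotProduct_add]
      ring
  · rintro d ⟨φ₁, h₁, φ₂, h₂, rfl⟩
    rw [Set.mem_ofPred_eq, ← add_sub_cancel phat φ₁, hgrow] at h₁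
    rw [Set.mem_ofPred_eq, ← add_sub_cancel phat φ₂, hgrow] at h₂
    have hsub := hpd.posSemidef.dotProduct_mulVec_sub_le (φ₁ - phat) (φ₂ - phat)
    rw [sub_sub_sub_cancel_right] at hsub
    have hL : 0 ≤ ⨆ i, hpd.inv.1.eigenvalues i :=
      Real.iSup_nonneg fun i => (hpd.inv.eigenvalues_pos i).le
    calc _ = (φ₁ - φ₂) ⬝ᵥ (φ₁ - φ₂) := hdist φ₁ φ₂
      _ ≤ (⨆ i, hpd.inv.1.eigenvalues i) * ((φ₁ - φ₂) ⬝ᵥ FIM *ᵥ (φ₁ - φ₂)) :=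
        hpd.dotProduct_self_le_iSup_eigenvalues_inv _
      _ ≤ (⨆ i, hpd.inv.1.eigenvalues i) * (4 * χ2) := by
        gcongr
        linarith
      _ = _ := mul_comm _ _
end

section
/- For the linear model with positive definite Fisher information matrix FIM and minimizer p̂ of the weighted least-squares objective J_w, the Lebesgue volume of the exact confidence region P_w = {p : J_w(p) − J_w(p̂) ≤ χ²_{α,n_p}} equals (χ²_{α,n_p})^{n_p/2} · √(det(FIM⁻¹)) · μ(B), where μ(B) is the volume of the Euclidean unit ball in ℝ^{n_p}. Hence in the linear case the exact D-optimal design coincides with the classical D-optimal design minimizing det(FIM⁻¹). -/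
open Matrix MeasureTheory Finset

open scoped MatrixOrder Matrix.Norms.L2Operator in
/-- Volume of the ellipsoid cut out by a positive definite quadratic form. -/
theorem volume_setOf_dotProduct_mulVec_le {n : ℕ} {M : Matrix (Fin n) (Fin n) ℝ}
    (hM : M.PosDef) {r : ℝ} (hr : 0 < r) :
    volume {x : Fin n → ℝ | x ⬝ᵥ M *ᵥ x ≤ r} =
      ENNReal.ofReal (r ^ ((n : ℝ) / 2) * Real.sqrt M⁻¹.det) *
        volume {x : Fin n → ℝ | ∑ i, x i ^ 2 ≤ 1} := by
  obtain ⟨A, hA⟩ := CStarAlgebra.nonneg_iff_eq_star_mul_self.mp hM.posSemidef.nonneg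
  rw [star_eq_conjTranspose, conjTranspose_eq_transpose_of_trivial] at hA
  have hdet : M.det = A.det ^ 2 := by rw [hA, det_mul, det_transpose, sq]
  have hA0 : A.det ≠ 0 := by
    intro h
    have := hM.det_pos
    simp [hdet, h] at this
  have hs : 0 < √r := Real.sqrt_pos.mpr hr
  have hf : LinearMap.det (Matrix.toLin' ((√r)⁻¹ • A)) = (√r)⁻¹ ^ n * A.det := by
    rw [LinearMap.det_toLin', det_smul, Fintype.card_fin]
  have hset : {x : Fin n → ℝ | x ⬝ᵥ M *ᵥ x ≤ r} =
      Matrix.toLin' ((√r)⁻¹ • A) ⁻¹' {x : Fin n → ℝ | ∑ i, x i ^ 2 ≤ 1} := by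
    ext x
    have hx : x ⬝ᵥ M *ᵥ x = ∑ i, (A *ᵥ x) i ^ 2 := by
      rw [hA, ← mulVec_mulVec, dotProduct_mulVec, vecMul_transpose]
      simp [dotProduct, sq]
    simp only [Set.mem_ofPred_eq, Set.mem_preimage, toLin'_apply, smul_mulVec, Pi.smul_apply,
      smul_eq_mul, mul_pow, ← Finset.mul_sum, hx, inv_pow, Real.sq_sqrt hr.le]
    rw [inv_mul_le_iff₀ hr, mul_one]
  have hscale : |((√r)⁻¹ ^ n * A.det)⁻¹| = r ^ ((n : ℝ) / 2) * √M⁻¹.det := by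
    have hpow : r ^ ((n : ℝ) / 2) = √r ^ n := by
      rw [Real.sqrt_eq_rpow, ← Real.rpow_natCast, ← Real.rpow_mul hr.le]
      congr 1
      ring
    rw [hpow, det_nonsing_inv, Ring.inverse_eq_inv', hdet, Real.sqrt_inv, Real.sqrt_sq_eq_abs,
      mul_inv, inv_pow, inv_inv, abs_mul, abs_inv, abs_of_pos (pow_pos hs n)]
  rw [hset, Measure.addHaar_preimage_linearMap _ (by rw [hf]; positivity), hf, hscale]

/-- A weighted sum of squared residuals is a quadratic polynomial around any point. -/
theorem weighted_sq_residuals_add_smul {np ny N : ℕ}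
    (Q : Fin N → Matrix (Fin ny) (Fin np) ℝ) (ym : Fin N → Fin ny → ℝ) (w : Fin ny → ℝ)
    (p d : Fin np → ℝ) (t : ℝ) :
    ∑ i, ∑ τ, w i * (ym τ i - (Q τ *ᵥ (p + t • d)) i) ^ 2 =
      (d ⬝ᵥ (∑ τ, (Q τ)ᵀ * diagonal w * Q τ) *ᵥ d) * (t * t) +
        (-2 * ∑ i, ∑ τ, w i * (ym τ i - (Q τ *ᵥ p) i) * (Q τ *ᵥ d) i) * t +
        ∑ i, ∑ τ, w i * (ym τ i - (Q τ *ᵥ p) i) ^ 2 := by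
  have hq : d ⬝ᵥ (∑ τ, (Q τ)ᵀ * diagonal w * Q τ) *ᵥ d =
      ∑ i, ∑ τ, w i * (Q τ *ᵥ d) i ^ 2 := by
    rw [sum_mulVec, dotProduct_sum, Finset.sum_comm]
    refine Finset.sum_congr rfl fun τ _ => ?_
    rw [← mulVec_mulVec, ← mulVec_mulVec, dotProduct_mulVec, vecMul_transpose]
    simp only [dotProduct, mulVec_diagonal]
    exact Finset.sum_congr rfl fun i _ => by ring
  simp only [hq, Finset.mul_sum, Finset.sum_mul, ← Finset.sum_add_distrib]
  refine Finset.sum_congr rfl fun i _ => Finset.sum_congr rfl fun τ _ => ?_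
  simp only [mulVec_add, mulVec_smul, Pi.add_apply, Pi.smul_apply, smul_eq_mul]
  ring

/-- Exact D-criterion in the linear case: the Lebesgue volume of the exact confidence
region equals `(χ²)^{n_p/2} √(det FIM⁻¹) · μ(B)`, `B` the closed Euclidean unit ball. -/
theorem stmt_12 {np ny N : ℕ}
    (Q : Fin N → Matrix (Fin ny) (Fin np) ℝ)
    (ym : Fin N → Fin ny → ℝ)
    (σ : Fin ny → ℝ) (hσ : ∀ i, 0 < σ i)
    (Jw : (Fin np → ℝ) → ℝ)
    (hJw : ∀ p, Jw p = ∑ i, ∑ τ, (σ i ^ 2)⁻¹ * (ym τ i - (Q τ).mulVec p i) ^ 2)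
    (FIM : Matrix (Fin np) (Fin np) ℝ)
    (hFIM : FIM = ∑ τ, (Q τ)ᵀ * Matrix.diagonal (fun i => (σ i ^ 2)⁻¹) * Q τ)
    (hpd : FIM.PosDef)
    (phat : Fin np → ℝ) (hphat : ∀ p, Jw phat ≤ Jw p)
    (χ2 : ℝ) (hχ2 : 0 < χ2) :
    volume {p : Fin np → ℝ | Jw p - Jw phat ≤ χ2} =
      ENNReal.ofReal (χ2 ^ ((np : ℝ) / 2) * Real.sqrt FIM⁻¹.det) *
        volume {x : Fin np → ℝ | ∑ i, x i ^ 2 ≤ 1} := by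
  have hquad (d : Fin np → ℝ) : Jw (phat + d) - Jw phat = d ⬝ᵥ FIM *ᵥ d := by
    have hexp := weighted_sq_residuals_add_smul Q ym (fun i => (σ i ^ 2)⁻¹) phat d
    simp only [← hJw, ← hFIM] at hexp
    set b := -2 * ∑ i, ∑ τ, (σ i ^ 2)⁻¹ * (ym τ i - (Q τ *ᵥ phat) i) * (Q τ *ᵥ d) i
    have hb : b = 0 := by
      have hdisc : discrim (d ⬝ᵥ FIM *ᵥ d) b 0 ≤ 0 :=
        discrim_le_zero fun t => by linarith [hexp t, hphat (phat + t • d)]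
      rw [discrim, mul_zero, sub_zero] at hdisc
      exact pow_eq_zero_iff two_ne_zero |>.mp (le_antisymm hdisc (sq_nonneg b))
    have h1 := hexp 1
    rw [one_smul, hb] at h1
    linarith
  rw [← volume_setOf_dotProduct_mulVec_le hpd hχ2,
    ← measure_preimage_add volume phat {p : Fin np → ℝ | Jw p - Jw phat ≤ χ2}]
  simp only [Set.preimage_ofPred_eq, hquad]
end
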